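/- For every n ≥ 2 and every 0 ≤ i ≤ n, there exists a group homomorphism η^i : Equiv.Perm (Fin n) →* Equiv.Perm (Fin (n+1)) such that η^i(τ_j) = τ_j for j < i, η^i(τ_i) = τ_{i+1} τ_i τ_{i+1}, and η^i(τ_j) = τ_{j+1} for j > i, where τ_j denotes the adjacent transposition swapping j−1 and j; moreover the square commutes: ν_{n+1} ∘ d^i = η^i ∘ ν_n as maps T_n → Equiv.Perm (Fin (n+1)). -/

import Mathlib

/-- Relators of the twin group `Tₘ`: squares of the generators, and far commutativity.
The generator indexed by `i : Fin (m-1)` is the twin `t_{i+1}` (1-based). -/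
def twinRels (m : ℕ) : Set (FreeGroup (Fin (m - 1))) :=
  {r | (∃ i : Fin (m - 1), r = FreeGroup.of i * FreeGroup.of i) ∨
       (∃ i j : Fin (m - 1), ((i : ℕ) + 2 ≤ (j : ℕ) ∨ (j : ℕ) + 2 ≤ (i : ℕ)) ∧
         r = FreeGroup.of i * FreeGroup.of j * (FreeGroup.of i)⁻¹ * (FreeGroup.of j)⁻¹)}

/-- The twin group `Tₘ` on `m` strands as a presented group. -/
abbrev TwinGroup (m : ℕ) : Type := PresentedGroup (twinRels m)

/-- The generator `t_{j+1}` (1-based) of `Tₘ`, for `j : Fin (m-1)`. -/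
def twinGen (m : ℕ) (j : Fin (m - 1)) : TwinGroup m := PresentedGroup.of j

/-- `IsCoface m i f` says that `f : Tₘ →* T_{m+1}` is the `i`-th coface homomorphism `dⁱ`
(`0 ≤ i ≤ m`): `dⁱ(t_j) = t_j` for `j < i`, `dⁱ(t_i) = t_{i+1} t_i t_{i+1}`, and
`dⁱ(t_j) = t_{j+1}` for `j > i`  (1-based `j`, so `t_j = twinGen m ⟨j-1, _⟩`). -/
def IsCoface (m i : ℕ) (f : TwinGroup m →* TwinGroup (m + 1)) : Prop :=
  ∀ j : Fin (m - 1),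
    (∀ _ : (j : ℕ) + 1 < i,
      f (twinGen m j) = twinGen (m + 1) ⟨(j : ℕ), by have := j.isLt; omega⟩) ∧
    (∀ _ : (j : ℕ) + 1 = i,
      f (twinGen m j) =
        twinGen (m + 1) ⟨i, by have := j.isLt; omega⟩ *
        twinGen (m + 1) ⟨i - 1, by have := j.isLt; omega⟩ *
        twinGen (m + 1) ⟨i, by have := j.isLt; omega⟩) ∧
    (∀ _ : i < (j : ℕ) + 1,
      f (twinGen m j) = twinGen (m + 1) ⟨(j : ℕ) + 1, by have := j.isLt; omega⟩)

/-- The adjacent transposition `τ_{k+1}` (1-based) in `Sₘ`, swapping `k` and `k+1`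
(0-based). -/
def tauPerm (m : ℕ) (k : Fin (m - 1)) : Equiv.Perm (Fin m) :=
  Equiv.swap ⟨(k : ℕ), by have := k.isLt; omega⟩ ⟨(k : ℕ) + 1, by have := k.isLt; omega⟩

/-- `ν : Tₘ →* Sₘ` is the canonical projection sending `t_j` to `τ_j`. -/
def IsNu (m : ℕ) (ν : TwinGroup m →* Equiv.Perm (Fin m)) : Prop :=
  ∀ j : Fin (m - 1), ν (twinGen m j) = tauPerm m j

/-- Extending a transposition along an embedding gives the transposition of the images. -/
theorem viaEmbeddingHom_swap {α β : Type*} [DecidableEq α] [DecidableEq β]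
    (e : α ↪ β) (a b : α) :
    Equiv.Perm.viaEmbeddingHom e (Equiv.swap a b) = Equiv.swap (e a) (e b) := by
  ext x
  rw [Equiv.Perm.viaEmbeddingHom_apply]
  by_cases hx : x ∈ Set.range e
  · obtain ⟨y, rfl⟩ := hx
    rw [Equiv.Perm.viaEmbedding_apply, e.injective.map_swap]
  · rw [Equiv.Perm.viaEmbedding_apply_of_notMem _ _ _ hx, Equiv.swap_apply_of_ne_of_ne]
    · rintro rfl
      exact hx ⟨a, rfl⟩
    · rintro rfl
      exact hx ⟨b, rfl⟩

/-- The homomorphism `Sₙ →* S_{n+1}` letting permutations act on the complement of `p`. -/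
noncomputable def skipHom {n : ℕ} (p : Fin (n + 1)) :
    Equiv.Perm (Fin n) →* Equiv.Perm (Fin (n + 1)) :=
  Equiv.Perm.viaEmbeddingHom p.succAboveEmb

theorem skipHom_swap {n : ℕ} (p : Fin (n + 1)) (a b : Fin n) :
    skipHom p (Equiv.swap a b) = Equiv.swap (p.succAbove a) (p.succAbove b) :=
  viaEmbeddingHom_swap _ a b

/-- For `n ≥ 2` and `0 ≤ i ≤ n` there is a homomorphism
`ηⁱ : Sₙ →* S_{n+1}` with `ηⁱ(τ_j) = τ_j` for `j < i`, `ηⁱ(τ_i) = τ_{i+1} τ_i τ_{i+1}`,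
`ηⁱ(τ_j) = τ_{j+1}` for `j > i`; moreover `ν_{n+1} ∘ dⁱ = ηⁱ ∘ νₙ`. -/
theorem eta_exists_and_square_commutes (n : ℕ) (hn : 2 ≤ n) (i : ℕ) (hi : i ≤ n)
    (ν : TwinGroup n →* Equiv.Perm (Fin n)) (hν : IsNu n ν)
    (ν' : TwinGroup (n + 1) →* Equiv.Perm (Fin (n + 1))) (hν' : IsNu (n + 1) ν')
    (d : TwinGroup n →* TwinGroup (n + 1)) (hd : IsCoface n i d) :
    ∃ η : Equiv.Perm (Fin n) →* Equiv.Perm (Fin (n + 1)),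
      (∀ k : Fin (n - 1),
        (∀ _ : (k : ℕ) + 1 < i,
          η (tauPerm n k) = tauPerm (n + 1) ⟨(k : ℕ), by have := k.isLt; omega⟩) ∧
        (∀ _ : (k : ℕ) + 1 = i,
          η (tauPerm n k) =
            tauPerm (n + 1) ⟨i, by have := k.isLt; omega⟩ *
            tauPerm (n + 1) ⟨i - 1, by have := k.isLt; omega⟩ *
            tauPerm (n + 1) ⟨i, by have := k.isLt; omega⟩) ∧
        (∀ _ : i < (k : ℕ) + 1,
          η (tauPerm n k) = tauPerm (n + 1) ⟨(k : ℕ) + 1, by have := k.isLt; omega⟩)) ∧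
      ν'.comp d = η.comp ν := by
  have h_eta : ∀ k : Fin (n - 1),
      (∀ _ : (k : ℕ) + 1 < i,
        skipHom ⟨i, Nat.lt_succ_of_le hi⟩ (tauPerm n k) =
          tauPerm (n + 1) ⟨(k : ℕ), by have := k.isLt; omega⟩) ∧
      (∀ _ : (k : ℕ) + 1 = i,
        skipHom ⟨i, Nat.lt_succ_of_le hi⟩ (tauPerm n k) =
          tauPerm (n + 1) ⟨i, by have := k.isLt; omega⟩ *
          tauPerm (n + 1) ⟨i - 1, by have := k.isLt; omega⟩ *
          tauPerm (n + 1) ⟨i, by have := k.isLt; omega⟩) ∧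
      (∀ _ : i < (k : ℕ) + 1,
        skipHom ⟨i, Nat.lt_succ_of_le hi⟩ (tauPerm n k) =
          tauPerm (n + 1) ⟨(k : ℕ) + 1, by have := k.isLt; omega⟩) := by
    intro k
    have hk := k.isLt
    refine ⟨fun h => ?_, fun h => ?_, fun h => ?_⟩ <;>
      simp only [tauPerm, skipHom_swap]
    · congr 1 <;> ext <;> simp [Fin.succAbove, Fin.lt_def] <;> split_ifs <;> simp <;> omega
    · subst h
      simp only [Nat.add_sub_cancel]
      rw [Equiv.swap_mul_swap_mul_swap, Equiv.swap_comm]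
      · congr 1 <;> ext <;> simp [Fin.succAbove, Fin.lt_def]
      all_goals rw [Ne, Fin.mk.injEq]; omega
    · congr 1 <;> ext <;> simp [Fin.succAbove, Fin.lt_def] <;> split_ifs <;> simp <;> omega
  refine ⟨skipHom ⟨i, Nat.lt_succ_of_le hi⟩, h_eta, PresentedGroup.ext fun k => ?_⟩
  change ν' (d (twinGen n k)) = skipHom _ (ν (twinGen n k))
  rw [hν k]
  rcases lt_trichotomy ((k : ℕ) + 1) i with h | h | h
  · rw [(hd k).1 h, (h_eta k).1 h, hν']
  · rw [(hd k).2.1 h, (h_eta k).2.1 h, map_mul, map_mul, hν', hν']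
  · rw [(hd k).2.2 h, (h_eta k).2.2 h, hν']
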